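/- Locally adaptive multiaccurate quantile estimation (Corollary 2). Let τ ≥ 1 be an integer, γ = 1/(2τ), and η = √((log((2|F|+1)·2τ) + 1)/τ), and assume η ≤ 1. Let q^(t) be the Fixed Share weights with parameters η, γ for the loss vectors ℓ^(t). Suppose that on every interval I = [r,s] ⊆ [T] of length |I| = τ the mixture losses are nonpositive: Σ_{t=r}^{s} ⟨q^(t), ℓ^(t)⟩ ≤ 0 (as holds when the randomized quantile predictor Θ_t is chosen by the minimax program of Algorithm 4). Then for every interval I = [r,s] ⊆ [T] of length τ: max{ max_{f∈F, σ∈{±1}} (1/τ)·Σ_{t=r}^{s} σ·f(x_t)·(c_t − α), (1/τ)·Σ_{t=r}^{s} d_t } ≤ 2·√((log((2|F|+1)·2τ) + 1)/τ). -/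

import Mathlib

open Finset in
/-- The log-partition function of a probability vector, for losses in `[-1, 1]`, is at most the
mean loss times the learning rate plus its square. -/
lemma log_sum_mul_exp_le {ι : Type*} [Fintype ι] {p ℓ : ι → ℝ} {η : ℝ}
    (hp : ∀ i, 0 ≤ p i) (hsum : ∑ i, p i = 1) (hℓ : ∀ i, |ℓ i| ≤ 1)
    (hη0 : 0 ≤ η) (hη1 : η ≤ 1) (hpos : 0 < ∑ i, p i * Real.exp (η * ℓ i)) :
    Real.log (∑ i, p i * Real.exp (η * ℓ i)) ≤ η * ∑ i, p i * ℓ i + η ^ 2 := by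
  have hexp (i : ι) : Real.exp (η * ℓ i) ≤ 1 + η * ℓ i + η ^ 2 := by
    have habs : |η * ℓ i| ≤ η := by
      rw [abs_mul, abs_of_nonneg hη0]
      exact mul_le_of_le_one_right hη0 (hℓ i)
    have hquad := (abs_le.mp (Real.abs_exp_sub_one_sub_id_le (habs.trans hη1))).2
    have hsq : (η * ℓ i) ^ 2 ≤ η ^ 2 := sq_le_sq' (by linarith [(abs_le.mp habs).1])
      (abs_le.mp habs).2
    linarith
  have hle : ∑ i, p i * Real.exp (η * ℓ i) ≤ 1 + η * ∑ i, p i * ℓ i + η ^ 2 :=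
    calc ∑ i, p i * Real.exp (η * ℓ i) ≤ ∑ i, p i * (1 + η * ℓ i + η ^ 2) :=
          sum_le_sum fun i _ => mul_le_mul_of_nonneg_left (hexp i) (hp i)
      _ = ∑ i, (p i + η * (p i * ℓ i) + p i * η ^ 2) := sum_congr rfl fun i _ => by ring
      _ = 1 + η * ∑ i, p i * ℓ i + η ^ 2 := by
          rw [sum_add_distrib, sum_add_distrib, ← mul_sum, ← sum_mul, hsum, one_mul]
  linarith [Real.log_le_sub_one_of_pos hpos]

section FixedShare

variable {ι : Type*} [Fintype ι] [Nonempty ι] {ℓ q : ℕ → ι → ℝ} {γ η : ℝ} {T : ℕ}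

/-- Fixed Share weights are probability vectors bounded below by the uniform mixing term. -/
lemma fixedShare_sum_eq_one_and_le (hγ0 : 0 < γ) (hγ1 : γ ≤ 1)
    (hq1 : ∀ i, q 1 i = 1 / (Fintype.card ι : ℝ))
    (hqrec : ∀ t ∈ Finset.Icc 1 T, ∀ i,
      q (t + 1) i = (1 - γ) * q t i * Real.exp (η * ℓ t i) /
        (∑ j, q t j * Real.exp (η * ℓ t j)) + γ / (Fintype.card ι : ℝ))
    {t : ℕ} (ht1 : 1 ≤ t) (htT : t ≤ T + 1) :
    ∑ i, q t i = 1 ∧ ∀ i, γ / (Fintype.card ι : ℝ) ≤ q t i := by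
  have hN : 0 < (Fintype.card ι : ℝ) := by exact_mod_cast Fintype.card_pos
  induction t, ht1 using Nat.le_induction with
  | base =>
    refine ⟨?_, fun i => ?_⟩
    · simp only [hq1, Finset.sum_const, Finset.card_univ, nsmul_eq_mul]
      field_simp
    · rw [hq1]
      gcongr
  | succ t ht1 ih =>
    obtain ⟨-, hlow⟩ := ih (by omega)
    have hqpos (i : ι) : 0 < q t i := (by positivity : 0 < γ / (Fintype.card ι : ℝ)).trans_le (hlow i)
    have hrec := hqrec t (Finset.mem_Icc.mpr ⟨ht1, by omega⟩)
    have hZ : 0 < ∑ j, q t j * Real.exp (η * ℓ t j) :=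
      Finset.sum_pos (fun j _ => mul_pos (hqpos j) (Real.exp_pos _)) Finset.univ_nonempty
    refine ⟨?_, fun i => ?_⟩
    · simp only [hrec, Finset.sum_add_distrib, Finset.sum_const, Finset.card_univ, nsmul_eq_mul,
        ← Finset.sum_div, mul_assoc, ← Finset.mul_sum]
      field_simp
      ring
    · rw [hrec]
      have : 0 ≤ (1 - γ) * q t i * Real.exp (η * ℓ t i) /
          (∑ j, q t j * Real.exp (η * ℓ t j)) :=
        div_nonneg (mul_nonneg (mul_nonneg (by linarith) (hqpos i).le) (Real.exp_pos _).le) hZ.le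
      linarith

/-- One step of Fixed Share moves the log-weight of an objective by at least its excess loss over
the mixture, up to second-order and sharing terms. -/
lemma fixedShare_log_succ (hγ0 : 0 < γ) (hγ1 : γ < 1) (hη0 : 0 ≤ η) (hη1 : η ≤ 1)
    (hℓ : ∀ t i, |ℓ t i| ≤ 1)
    (hq1 : ∀ i, q 1 i = 1 / (Fintype.card ι : ℝ))
    (hqrec : ∀ t ∈ Finset.Icc 1 T, ∀ i,
      q (t + 1) i = (1 - γ) * q t i * Real.exp (η * ℓ t i) /
        (∑ j, q t j * Real.exp (η * ℓ t j)) + γ / (Fintype.card ι : ℝ))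
    {t : ℕ} (ht1 : 1 ≤ t) (htT : t ≤ T) (i : ι) :
    Real.log (1 - γ) + η * ℓ t i - η * ∑ j, q t j * ℓ t j - η ^ 2 ≤
      Real.log (q (t + 1) i) - Real.log (q t i) := by
  have hN : 0 < (Fintype.card ι : ℝ) := by exact_mod_cast Fintype.card_pos
  obtain ⟨hsum, hlow⟩ := fixedShare_sum_eq_one_and_le hγ0 hγ1.le hq1 hqrec ht1 (by omega)
  have hqpos (j : ι) : 0 < q t j := (by positivity : 0 < γ / (Fintype.card ι : ℝ)).trans_le (hlow j)
  have hZ : 0 < ∑ j, q t j * Real.exp (η * ℓ t j) :=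
    Finset.sum_pos (fun j _ => mul_pos (hqpos j) (Real.exp_pos _)) Finset.univ_nonempty
  have hlogZ := log_sum_mul_exp_le (fun j => (hqpos j).le) hsum (hℓ t) hη0 hη1 hZ
  have hγ' : 0 < 1 - γ := by linarith
  have hnum : 0 < (1 - γ) * q t i := mul_pos hγ' (hqpos i)
  have hstep : Real.log ((1 - γ) * q t i * Real.exp (η * ℓ t i) /
      (∑ j, q t j * Real.exp (η * ℓ t j))) ≤ Real.log (q (t + 1) i) := by
    refine Real.log_le_log (by positivity) ?_
    rw [hqrec t (Finset.mem_Icc.mpr ⟨ht1, htT⟩)]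
    exact le_add_of_nonneg_right (by positivity)
  rw [Real.log_div (by positivity) hZ.ne', Real.log_mul hnum.ne' (Real.exp_pos _).ne',
    Real.log_mul hγ'.ne' (hqpos i).ne', Real.log_exp] at hstep
  linarith

/-- Interval regret bound for Fixed Share. -/
lemma fixedShare_regret (hγ0 : 0 < γ) (hγ1 : γ < 1) (hη0 : 0 ≤ η) (hη1 : η ≤ 1)
    (hℓ : ∀ t i, |ℓ t i| ≤ 1)
    (hq1 : ∀ i, q 1 i = 1 / (Fintype.card ι : ℝ))
    (hqrec : ∀ t ∈ Finset.Icc 1 T, ∀ i,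
      q (t + 1) i = (1 - γ) * q t i * Real.exp (η * ℓ t i) /
        (∑ j, q t j * Real.exp (η * ℓ t j)) + γ / (Fintype.card ι : ℝ))
    {r s : ℕ} (hr : 1 ≤ r) (hrs : r ≤ s) (hsT : s ≤ T) (i : ι) :
    η * ∑ t ∈ Finset.Icc r s, ℓ t i ≤
      η * ∑ t ∈ Finset.Icc r s, ∑ j, q t j * ℓ t j + Real.log (Fintype.card ι / γ) +
        (s + 1 - r) * (η ^ 2 - Real.log (1 - γ)) := by
  have hN : 0 < (Fintype.card ι : ℝ) := by exact_mod_cast Fintype.card_pos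
  have hw {t : ℕ} := fixedShare_sum_eq_one_and_le (t := t) hγ0 hγ1.le hq1 hqrec
  have htel : ∑ t ∈ Finset.Icc r s, (Real.log (q (t + 1) i) - Real.log (q t i)) =
      Real.log (q (s + 1) i) - Real.log (q r i) := by
    rw [← Finset.Ico_add_one_right_eq_Icc]
    exact Finset.sum_Ico_sub (fun t => Real.log (q t i)) (by omega)
  have hsteps := Finset.sum_le_sum fun t (ht : t ∈ Finset.Icc r s) =>
    fixedShare_log_succ hγ0 hγ1 hη0 hη1 hℓ hq1 hqrec
      (hr.trans (Finset.mem_Icc.mp ht).1) ((Finset.mem_Icc.mp ht).2.trans hsT) i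
  have hlast : Real.log (q (s + 1) i) ≤ 0 := by
    obtain ⟨hsum, hlow⟩ := hw (by omega : 1 ≤ s + 1) (by omega)
    have hnn (j : ι) : 0 ≤ q (s + 1) j :=
      (by positivity : 0 ≤ γ / (Fintype.card ι : ℝ)).trans (hlow j)
    exact Real.log_nonpos (hnn i)
      (hsum ▸ Finset.single_le_sum (fun j _ => hnn j) (Finset.mem_univ i))
  have hfirst : -Real.log (Fintype.card ι / γ) ≤ Real.log (q r i) := by
    rw [← Real.log_inv, inv_div]
    exact Real.log_le_log (by positivity) ((hw hr (by omega)).2 i)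
  rw [htel] at hsteps
  simp only [Finset.sum_sub_distrib, Finset.sum_add_distrib, ← Finset.mul_sum, Finset.sum_const,
    Nat.card_Icc, nsmul_eq_mul] at hsteps
  push_cast [Nat.cast_sub (by omega : r ≤ s + 1)] at hsteps
  linarith

end FixedShare

/-- With sharing rate `1 / (2 * τ)`, the total sharing cost over `τ` rounds is at most one. -/
lemma neg_mul_log_one_sub_le_one {τ : ℝ} (hτ : 1 ≤ τ) :
    -(τ * Real.log (1 - 1 / (2 * τ))) ≤ 1 := by
  have hpos : 0 < 2 * τ - 1 := by linarith
  have hbase : 1 - 1 / (2 * τ) = (2 * τ - 1) / (2 * τ) := by field_simp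
  have hlog := Real.one_sub_inv_le_log_of_pos
    (show 0 < 1 - 1 / (2 * τ) by rw [hbase]; positivity)
  have hinv : 1 - (1 - 1 / (2 * τ))⁻¹ = -(1 / (2 * τ - 1)) := by
    rw [hbase, inv_div]
    field_simp
    ring
  rw [hinv] at hlog
  have hfrac : τ * (1 / (2 * τ - 1)) ≤ 1 := by
    rw [mul_one_div, div_le_one hpos]
    linarith
  nlinarith [mul_le_mul_of_nonneg_left hlog (by linarith : 0 ≤ τ)]

/-- **Locally adaptive multiaccurate quantile estimation (Corollary 2).**
Objectives are indexed by `Option (F × Bool)`: `some (f, σ)` is the multiaccurate-coverage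
objective `σ·f(x_t)·(c_t − α)` where `c_t ∈ [0,1]` is the expected coverage of the randomized
quantile prediction, and `none` is the expected pinball-loss difference `d_t ∈ [−1,1]`
relative to the baseline quantile prediction; the objective set has cardinality `2|F|+1`.
With `γ = 1/(2τ)`, `η = √((log((2|F|+1)·2τ)+1)/τ) ≤ 1`, Fixed Share weights `q`, and
mixture losses nonpositive on every length-`τ` interval, every interval `I = [r,s] ⊆ [T]`
of length `τ` satisfies
`max{ max_{f,σ} (1/τ)·Σ σ f(x_t)(c_t − α), (1/τ)·Σ d_t } ≤ 2·√((log((2|F|+1)·2τ)+1)/τ)`. -/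
theorem locally_adaptive_multiaccurate_quantile_estimation
    {X : Type*} {F : Type*} [Fintype F] [Nonempty F]
    (fv : F → X → ℝ) (hfv : ∀ f x, fv f x ∈ Set.Icc (0 : ℝ) 1)
    (α : ℝ) (hα : α ∈ Set.Ioo (0 : ℝ) 1)
    (T : ℕ) (hT : 1 ≤ T)
    (x : ℕ → X) (cov d : ℕ → ℝ)
    (hcov : ∀ t, cov t ∈ Set.Icc (0 : ℝ) 1) (hd : ∀ t, d t ∈ Set.Icc (-1 : ℝ) 1)
    (ℓ : ℕ → Option (F × Bool) → ℝ)
    (hℓMA : ∀ t (f : F) (σ : Bool),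
      ℓ t (some (f, σ)) = (if σ then (1 : ℝ) else -1) * fv f (x t) * (cov t - α))
    (hℓpred : ∀ t, ℓ t none = d t)
    (τ : ℕ) (hτ : 1 ≤ τ)
    (γ η : ℝ)
    (hγdef : γ = 1 / (2 * (τ : ℝ)))
    (hηdef : η = Real.sqrt
      ((Real.log ((2 * (Fintype.card F : ℝ) + 1) * (2 * (τ : ℝ))) + 1) / (τ : ℝ)))
    (hη1 : η ≤ 1)
    (q : ℕ → Option (F × Bool) → ℝ)
    (hq1 : ∀ i, q 1 i = 1 / (2 * (Fintype.card F : ℝ) + 1))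
    (hqrec : ∀ t ∈ Finset.Icc 1 T, ∀ i,
      q (t + 1) i = (1 - γ) * q t i * Real.exp (η * ℓ t i) /
          (∑ j, q t j * Real.exp (η * ℓ t j)) + γ / (2 * (Fintype.card F : ℝ) + 1))
    (hmix : ∀ r s : ℕ, 1 ≤ r → r ≤ s → s ≤ T → s + 1 = r + τ →
      ∑ t ∈ Finset.Icc r s, ∑ i, q t i * ℓ t i ≤ 0)
    (r s : ℕ) (hr : 1 ≤ r) (hrs : r ≤ s) (hsT : s ≤ T) (hlen : s + 1 = r + τ) :
    max
      (Finset.univ.sup' Finset.univ_nonempty fun fσ : F × Bool =>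
        (1 / (τ : ℝ)) * ∑ t ∈ Finset.Icc r s,
          (if fσ.2 then (1 : ℝ) else -1) * fv fσ.1 (x t) * (cov t - α))
      ((1 / (τ : ℝ)) * ∑ t ∈ Finset.Icc r s, d t)
      ≤ 2 * Real.sqrt
          ((Real.log ((2 * (Fintype.card F : ℝ) + 1) * (2 * (τ : ℝ))) + 1) / (τ : ℝ)) := by
  have hτ' : (1 : ℝ) ≤ τ := by exact_mod_cast hτ
  have hcard : (Fintype.card (Option (F × Bool)) : ℝ) = 2 * (Fintype.card F : ℝ) + 1 := by
    simp [mul_comm]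
  have hlog : 0 ≤ Real.log ((2 * (Fintype.card F : ℝ) + 1) * (2 * (τ : ℝ))) :=
    Real.log_nonneg (one_le_mul_of_one_le_of_one_le
      (by linarith [Nat.cast_nonneg (α := ℝ) (Fintype.card F)]) (by linarith))
  have hη0 : 0 < η := by
    rw [hηdef]
    positivity
  have hηsq : η ^ 2 * τ =
      Real.log ((2 * (Fintype.card F : ℝ) + 1) * (2 * (τ : ℝ))) + 1 := by
    rw [hηdef, Real.sq_sqrt (by positivity)]
    field_simp
  have hγ0 : 0 < γ := by
    rw [hγdef]
    positivity
  have hγ1 : γ < 1 := by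
    rw [hγdef, div_lt_one (by positivity)]
    linarith
  have hℓ (t : ℕ) (i : Option (F × Bool)) : |ℓ t i| ≤ 1 := by
    rcases i with _ | ⟨f, σ⟩
    · rw [hℓpred]
      exact abs_le.mpr (hd t)
    · have hsign : |if σ then (1 : ℝ) else -1| = 1 := by cases σ <;> simp
      rw [hℓMA, abs_mul, abs_mul, hsign, one_mul, abs_of_nonneg (hfv f (x t)).1]
      exact mul_le_one₀ (hfv f (x t)).2 (abs_nonneg _)
        (abs_le.mpr ⟨by linarith [(hcov t).1, hα.2], by linarith [(hcov t).2, hα.1]⟩)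
  have hbound (i : Option (F × Bool)) :
      (1 / (τ : ℝ)) * ∑ t ∈ Finset.Icc r s, ℓ t i ≤ 2 * η := by
    have hregret := fixedShare_regret hγ0 hγ1 hη0.le hη1 hℓ (by simpa only [hcard] using hq1)
      (by simpa only [hcard] using hqrec) hr hrs hsT i
    have hlen' : (s : ℝ) + 1 - r = τ := by
      have : (s : ℝ) + 1 = r + τ := by exact_mod_cast hlen
      linarith
    have hmixη := mul_nonpos_of_nonneg_of_nonpos hη0.le (hmix r s hr hrs hsT hlen)
    have hshare := neg_mul_log_one_sub_le_one hτ'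
    rw [← hγdef] at hshare
    have hprior : (2 * (Fintype.card F : ℝ) + 1) / γ =
        (2 * (Fintype.card F : ℝ) + 1) * (2 * (τ : ℝ)) := by
      rw [hγdef, div_div_eq_mul_div, div_one]
    rw [hlen', hcard, hprior] at hregret
    have hsum : ∑ t ∈ Finset.Icc r s, ℓ t i ≤ 2 * η * τ :=
      le_of_mul_le_mul_left (by linarith) hη0
    rw [one_div_mul_eq_div]
    exact (div_le_iff₀ (by linarith)).mpr hsum
  rw [← hηdef]
  refine max_le (Finset.sup'_le _ _ fun fσ _ => ?_) ?_
  · simpa only [hℓMA] using hbound (some fσ)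
  · simpa only [hℓpred] using hbound none
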